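/- arXiv:2104.05056 — 2 statements merged into one kernel-verified Lean document; each statement's English description precedes it below -/
import Mathlib

section
/- Let Ω ⊂ P(ℝ^d) be a properly convex domain with Hilbert metric d_Ω and let S ⊂ Ω be a properly embedded simplex of dimension k. Then (S, d_Ω) is quasi-isometric to ℝ^k: there exist constants A ≥ 1 and B ≥ 0 and a map f : ℝ^k → S such that (1/A)·‖u − v‖ − B ≤ d_Ω(f(u), f(v)) ≤ A·‖u − v‖ + B for all u, v ∈ ℝ^k, and every point of S lies within d_Ω-distance B of the image of f. -/
open Set Filter

noncomputable section

/-- Real projective space `P(ℝ^d)`, with the quotient topology. -/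
abbrev PSpace (d : ℕ) := Projectivization ℝ (Fin d → ℝ)

instance PSpace.instTopologicalSpace (d : ℕ) : TopologicalSpace (PSpace d) :=
  inferInstanceAs (TopologicalSpace (Quotient (projectivizationSetoid ℝ (Fin d → ℝ))))

namespace Paper

variable {d : ℕ}

/-- Inhomogeneous coordinates in the affine chart determined by the linear functional `f`:
a projective point `[v]` with `f v ≠ 0` is sent to the representative `v / f v` lying in the
affine hyperplane `{f = 1}`. -/
def chartMap (f : (Fin d → ℝ) →ₗ[ℝ] ℝ) (x : PSpace d) : Fin d → ℝ :=
  (f x.rep)⁻¹ • x.rep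

/-- A subset of `P(ℝ^d)` is properly convex if there is an affine chart in which it is a
bounded convex set. -/
def IsProperlyConvex (C : Set (PSpace d)) : Prop :=
  ∃ f : (Fin d → ℝ) →ₗ[ℝ] ℝ, (∀ x ∈ closure C, f x.rep ≠ 0) ∧
    Convex ℝ (chartMap f '' C) ∧ Bornology.IsBounded (chartMap f '' C)

/-- A properly convex domain: an open, nonempty, properly convex subset of `P(ℝ^d)`. -/
def IsPCDomain (Ω : Set (PSpace d)) : Prop :=
  IsOpen Ω ∧ Ω.Nonempty ∧ IsProperlyConvex Ω

open Classical in
/-- A choice of an affine chart containing the properly convex set `C`. -/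
def chartOf (C : Set (PSpace d)) : (Fin d → ℝ) →ₗ[ℝ] ℝ :=
  if h : IsProperlyConvex C then h.choose else 0

/-- The chart map associated to the chosen chart of `C`. -/
def cmap (C : Set (PSpace d)) : PSpace d → Fin d → ℝ := chartMap (chartOf C)

/-- The Hilbert distance between `u` and `v` computed in an affine chart where the convex set
is `O`: writing the line through `u, v` as `t ↦ u + t(v-u)`, with boundary parameters
`tm = inf {t | u + t(v-u) ∈ O} ≤ 0` and `tp = sup {...} ≥ 1`, the cross-ratio
`[a,u,v,b]` of `a = u + tm(v-u), u, v, b = u + tp(v-u)` equals `(tp(1-tm))/((-tm)(tp-1))`. -/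
def hilbertDistChart (O : Set (Fin d → ℝ)) (u v : Fin d → ℝ) : ℝ :=
  if u = v then 0
  else
    (1 / 2) * Real.log
      ((sSup {t : ℝ | u + t • (v - u) ∈ O} * (1 - sInf {t : ℝ | u + t • (v - u) ∈ O})) /
        ((-(sInf {t : ℝ | u + t • (v - u) ∈ O})) * (sSup {t : ℝ | u + t • (v - u) ∈ O} - 1)))

/-- The Hilbert metric of a properly convex set `C` (open in its span). -/
def hilbertDist (C : Set (PSpace d)) (x y : PSpace d) : ℝ :=
  hilbertDistChart (cmap C '' C) (cmap C x) (cmap C y)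

/-- The closed projective line segment `[x,y]` contained in `closure C`. -/
def projSeg (C : Set (PSpace d)) (x y : PSpace d) : Set (PSpace d) :=
  {z ∈ closure C | cmap C z ∈ segment ℝ (cmap C x) (cmap C y)}

/-- The open projective line segment `(x,y)` contained in `closure C`. -/
def projOpenSeg (C : Set (PSpace d)) (x y : PSpace d) : Set (PSpace d) :=
  {z ∈ closure C | cmap C z ∈ openSegment ℝ (cmap C x) (cmap C y)}

/-- The open face `F_C(x)` of a point `x ∈ closure C`: the set `{x}` together with all
`y ∈ closure C` such that some open line segment contained in `closure C` contains
both `x` and `y`. -/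
def face (C : Set (PSpace d)) (x : PSpace d) : Set (PSpace d) :=
  insert x {y ∈ closure C | ∃ a ∈ closure C, ∃ b ∈ closure C,
    x ∈ projOpenSeg C a b ∧ y ∈ projOpenSeg C a b}

/-- The ideal boundary `∂_i C = closure C \ C`. -/
def idealBdry (C : Set (PSpace d)) : Set (PSpace d) := closure C \ C

/-- The dimension of a subset `B`, computed in the chart of the ambient convex set `C`. -/
def pdimIn (C B : Set (PSpace d)) : ℕ :=
  Module.finrank ℝ (affineSpan ℝ (cmap C '' B)).direction

/-- The dimension of a convex subset of `P(ℝ^d)`. -/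
def pdim (A : Set (PSpace d)) : ℕ := pdimIn A A

/-- The coarse dimension `cdim_C(A)` of a nonempty subset `A` of a properly convex set `C`
open in its span: the smallest `k` such that `A` is contained in an `R`-neighborhood (for the
Hilbert metric of `C`) of a `k`-dimensional convex subset `B ⊆ C`. -/
def cdim (C A : Set (PSpace d)) : ℕ :=
  sInf {k : ℕ | ∃ R : ℝ, 0 < R ∧ ∃ B : Set (PSpace d), B ⊆ C ∧
    Convex ℝ (cmap C '' B) ∧ pdimIn C B = k ∧
    A ⊆ {p ∈ C | ∃ q ∈ B, hilbertDist C p q < R}}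

/-- The cone over the standard open `(p-1)`-dimensional simplex: vectors whose first `p`
coordinates are positive and whose remaining coordinates vanish. -/
def simplexCone (p : ℕ) : Set (Fin d → ℝ) :=
  {v | (∀ i : Fin d, (i : ℕ) < p → 0 < v i) ∧ ∀ i : Fin d, p ≤ (i : ℕ) → v i = 0}

/-- `S` is the image under `g ∈ PGL_d(ℝ)` of the standard open simplex with `p` vertices. -/
def IsSimplexWithMap (p : ℕ) (S : Set (PSpace d)) (g : (Fin d → ℝ) ≃ₗ[ℝ] (Fin d → ℝ)) : Prop :=
  S = {q : PSpace d | ∃ v ∈ simplexCone (d := d) p, ∃ hv : v ≠ 0,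
        q = Projectivization.mk ℝ (g v) (by simpa using hv)}

/-- `S ⊆ P(ℝ^d)` is a simplex of dimension `k`. -/
def IsSimplexOfDim (k : ℕ) (S : Set (PSpace d)) : Prop :=
  k + 1 ≤ d ∧ ∃ g : (Fin d → ℝ) ≃ₗ[ℝ] (Fin d → ℝ), IsSimplexWithMap (k + 1) S g

/-- `S` is a simplex with vertices `v 0, …, v (p-1)` (so of dimension `p - 1`). -/
def HasVertices {p : ℕ} (S : Set (PSpace d)) (v : Fin p → PSpace d) : Prop :=
  ∃ (hp : p ≤ d) (g : (Fin d → ℝ) ≃ₗ[ℝ] (Fin d → ℝ)),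
    IsSimplexWithMap p S g ∧
    ∀ j : Fin p, v j = Projectivization.mk ℝ (g (Pi.single (Fin.castLE hp j) 1))
      (by
        simp only [ne_eq, EmbeddingLike.map_eq_zero_iff]
        intro h
        have h1 := congrFun h (Fin.castLE hp j)
        rw [Pi.single_eq_same] at h1
        exact one_ne_zero (α := ℝ) h1)

/-- `A ⊆ B` is properly embedded if the inclusion map `A ↪ B` is proper. -/
def IsProperlyEmbedded (A B : Set (PSpace d)) : Prop :=
  ∃ h : A ⊆ B, IsProperMap (Set.inclusion h)

/-- The projective action of `GL(ℝ^d)` (hence of `PGL_d(ℝ)`) on `P(ℝ^d)`. -/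
def pact (g : (Fin d → ℝ) ≃ₗ[ℝ] (Fin d → ℝ)) : PSpace d → PSpace d :=
  Projectivization.map g.toLinearMap g.injective

/-- A naive convex co-compact triple `(Ω, C, Λ)`. -/
structure NCCTriple (d : ℕ) where
  Ω : Set (PSpace d)
  C : Set (PSpace d)
  Λ : Subgroup ((Fin d → ℝ) ≃ₗ[ℝ] (Fin d → ℝ))
  isOpen_Ω : IsOpen Ω
  nonempty_Ω : Ω.Nonempty
  properlyConvex_Ω : IsProperlyConvex Ω
  inv_Ω : ∀ g ∈ Λ, pact g '' Ω = Ω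
  infinite_Λ : (Λ : Set ((Fin d → ℝ) ≃ₗ[ℝ] (Fin d → ℝ))).Infinite
  discrete_Λ : ∀ K ⊆ Ω, IsCompact K →
    {g : (Fin d → ℝ) ≃ₗ[ℝ] (Fin d → ℝ) | g ∈ Λ ∧ (pact g '' K ∩ K).Nonempty}.Finite
  C_nonempty : C.Nonempty
  C_sub : C ⊆ Ω
  C_closedInΩ : closure C ∩ Ω ⊆ C
  C_convex : Convex ℝ (cmap Ω '' C)
  inv_C : ∀ g ∈ Λ, pact g '' C = C
  cocompact : ∃ K : Set (PSpace d), K ⊆ C ∧ IsCompact K ∧ C ⊆ ⋃ g ∈ Λ, pact g '' K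

/-- The orbit of a point under a subgroup of `PGL_d(ℝ)`. -/
def porbit (Λ : Subgroup ((Fin d → ℝ) ≃ₗ[ℝ] (Fin d → ℝ))) (p : PSpace d) : Set (PSpace d) :=
  {q | ∃ g ∈ Λ, q = pact g p}

/-- The full orbital limit set `L_Ω(Λ)`. -/
def limitSet (Ω : Set (PSpace d)) (Λ : Subgroup ((Fin d → ℝ) ≃ₗ[ℝ] (Fin d → ℝ))) :
    Set (PSpace d) :=
  ⋃ p ∈ Ω, (closure (porbit Λ p) \ porbit Λ p)

/-- The convex hull of `X ⊆ closure Ω` taken inside `Ω`. -/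
def convHullIn (Ω X : Set (PSpace d)) : Set (PSpace d) :=
  {z ∈ Ω | cmap Ω z ∈ convexHull ℝ (cmap Ω '' X)}

/-- `C_Ω(Λ)`: the convex hull of the full orbital limit set in `Ω`. -/
def coreC (Ω : Set (PSpace d)) (Λ : Subgroup ((Fin d → ℝ) ≃ₗ[ℝ] (Fin d → ℝ))) :
    Set (PSpace d) :=
  convHullIn Ω (limitSet Ω Λ)

/-- A convex co-compact group `Λ ⊆ Aut(Ω)`: an infinite discrete subgroup preserving `Ω`
such that `C_Ω(Λ)` is nonempty and `Λ` acts cocompactly on it. -/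
structure CCSetup (d : ℕ) where
  Ω : Set (PSpace d)
  Λ : Subgroup ((Fin d → ℝ) ≃ₗ[ℝ] (Fin d → ℝ))
  isOpen_Ω : IsOpen Ω
  nonempty_Ω : Ω.Nonempty
  properlyConvex_Ω : IsProperlyConvex Ω
  inv_Ω : ∀ g ∈ Λ, pact g '' Ω = Ω
  infinite_Λ : (Λ : Set ((Fin d → ℝ) ≃ₗ[ℝ] (Fin d → ℝ))).Infinite
  discrete_Λ : ∀ K ⊆ Ω, IsCompact K →
    {g : (Fin d → ℝ) ≃ₗ[ℝ] (Fin d → ℝ) | g ∈ Λ ∧ (pact g '' K ∩ K).Nonempty}.Finite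
  core_nonempty : (coreC Ω Λ).Nonempty
  cocompact : ∃ K : Set (PSpace d), K ⊆ coreC Ω Λ ∧ IsCompact K ∧
    coreC Ω Λ ⊆ ⋃ g ∈ Λ, pact g '' K

/-- The Gromov product of `x, y` at `w`, with respect to the Hilbert metric of `Ω`. -/
def gromovProd (Ω : Set (PSpace d)) (w x y : PSpace d) : ℝ :=
  (hilbertDist Ω x w + hilbertDist Ω y w - hilbertDist Ω x y) / 2

/-- `(C, d_Ω)` is Gromov hyperbolic. -/
def GromovHyperbolicOn (Ω C : Set (PSpace d)) : Prop :=
  ∃ δ : ℝ, 0 ≤ δ ∧ ∀ x ∈ C, ∀ y ∈ C, ∀ z ∈ C, ∀ w ∈ C,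
    min (gromovProd Ω w x y) (gromovProd Ω w y z) - δ ≤ gromovProd Ω w x z

/-- The open Hilbert-metric ball in `Ω`. -/
def hBall (Ω : Set (PSpace d)) (x : PSpace d) (r : ℝ) : Set (PSpace d) :=
  {y ∈ Ω | hilbertDist Ω x y < r}

/-- The Hausdorff distance between `A` and `B` (w.r.t. the Hilbert metric of `Ω`)
is less than `ε`. -/
def hausLT (Ω A B : Set (PSpace d)) (ε : ℝ) : Prop :=
  (∀ a ∈ A, ∃ b ∈ B, hilbertDist Ω a b < ε) ∧ ∀ b ∈ B, ∃ a ∈ A, hilbertDist Ω a b < ε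

/-- The Hausdorff distance between `A` and `B` (w.r.t. the Hilbert metric of `Ω`)
is at most `r`. -/
def hausdorffDistLE (Ω A B : Set (PSpace d)) (r : ℝ) : Prop :=
  ∀ ε : ℝ, 0 < ε → hausLT Ω A B (r + ε)

/-- Convergence `F n → C` in the local Hausdorff topology induced by `d_Ω`. -/
def LocalHausConv (Ω : Set (PSpace d)) (F : ℕ → Set (PSpace d)) (C : Set (PSpace d)) : Prop :=
  ∀ x ∈ Ω, ∀ r : ℝ, 0 < r → ∀ ε : ℝ, 0 < ε →
    ∀ᶠ n in atTop, hausLT Ω (F n ∩ hBall Ω x r) (C ∩ hBall Ω x r) ε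

/-- A collection `𝒮` of closed subsets of `Ω` is closed and discrete in the local Hausdorff
topology: any sequence in `𝒮` converging to a nonempty closed subset of `Ω` has limit in `𝒮`
and is eventually equal to its limit. -/
def ClosedAndDiscreteInLHT (Ω : Set (PSpace d)) (𝒮 : Set (Set (PSpace d))) : Prop :=
  ∀ F : ℕ → Set (PSpace d), (∀ n, F n ∈ 𝒮) →
    ∀ C : Set (PSpace d), C.Nonempty → C ⊆ Ω → closure C ∩ Ω ⊆ C → LocalHausConv Ω F C →
      C ∈ 𝒮 ∧ ∀ᶠ n in atTop, F n = C



lemma exit_aux {n : ℕ} (p q : Fin (n+1) → ℝ) (hp : ∀ i, 0 < p i) (hq : ∃ i, q i ≤ 0) :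
    ∃ s : ℝ, 0 ≤ s ∧ s ≤ 1 ∧ (∀ i, 0 ≤ (1 - s) * p i + s * q i) ∧
      ∃ i, (1 - s) * p i + s * q i = 0 := by
  obtain ⟨i, -, hi⟩ := Finset.exists_max_image Finset.univ (fun i => (p i - q i) / p i)
    ⟨0, Finset.mem_univ _⟩
  obtain ⟨j, hj⟩ := hq
  have h1 : 1 ≤ (p i - q i) / p i := by
    refine le_trans ?_ (hi j (Finset.mem_univ _))
    rw [le_div_iff₀ (hp j)]; linarith
  set m := (p i - q i) / p i with hm
  have hm0 : 0 < m := by linarith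
  have hmi : m * p i = p i - q i := by rw [hm]; field_simp [(hp i).ne']
  refine ⟨1 / m, by positivity, by rw [div_le_one hm0]; exact h1, ?_, i, ?_⟩
  · intro l
    have h2 : (p l - q l) / p l ≤ m := hi l (Finset.mem_univ _)
    rw [div_le_iff₀ (hp l)] at h2
    have : (1 - 1 / m) * p l + 1 / m * q l = (m * p l - (p l - q l)) / m := by
      field_simp; ring
    rw [this]
    apply div_nonneg _ hm0.le
    linarith
  · have : (1 - 1 / m) * p i + 1 / m * q i = (m * p i - (p i - q i)) / m := by
      field_simp; ring
    rw [this, hmi]; simp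

lemma hilb_formula {n : ℕ} (O : Set (Fin d → ℝ)) (hO : Convex ℝ O)
    (W : (Fin (n+1) → ℝ) →ₗ[ℝ] (Fin d → ℝ)) (hW : Function.Injective W)
    (h1 : ∀ p : Fin (n+1) → ℝ, (∀ i, 0 < p i) → ∑ i, p i = 1 → W p ∈ O)
    (h2 : ∀ p : Fin (n+1) → ℝ, (∀ i, 0 ≤ p i) → ∑ i, p i = 1 → W p ∈ O → ∀ i, 0 < p i)
    (p q : Fin (n+1) → ℝ) (hp : ∀ i, 0 < p i) (hq : ∀ i, 0 < q i)
    (hps : ∑ i, p i = 1) (hqs : ∑ i, q i = 1) :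
    ∃ i j, (∀ l, p l / q l ≤ p i / q i) ∧ (∀ l, p j / q j ≤ p l / q l) ∧
      hilbertDistChart O (W p) (W q) = 1 / 2 * Real.log ((p i / q i) / (p j / q j)) := by
  obtain ⟨i, -, hi⟩ := Finset.exists_max_image Finset.univ (fun i => p i / q i)
    ⟨0, Finset.mem_univ _⟩
  obtain ⟨j, -, hj⟩ := Finset.exists_min_image Finset.univ (fun i => p i / q i)
    ⟨0, Finset.mem_univ _⟩
  replace hi : ∀ l, p l / q l ≤ p i / q i := fun l => hi l (Finset.mem_univ _)
  replace hj : ∀ l, p j / q j ≤ p l / q l := fun l => hj l (Finset.mem_univ _)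
  refine ⟨i, j, hi, hj, ?_⟩
  by_cases hpq : p = q
  · subst hpq
    have : ∀ l, p l / p l = 1 := fun l => div_self (hp l).ne'
    simp [hilbertDistChart, this]
  have hWne : W p ≠ W q := fun h => hpq (hW h)
  have hR : 1 < p i / q i := by
    by_contra hcon
    push Not at hcon
    apply hpq
    have hle : ∀ l ∈ Finset.univ, p l ≤ q l := by
      intro l _
      have := (hi l).trans hcon
      rwa [div_le_one (hq l)] at this
    have := (Finset.sum_eq_sum_iff_of_le hle).1 (hps.trans hqs.symm)
    funext l; exact this l (Finset.mem_univ _)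
  have hr : p j / q j < 1 := by
    by_contra hcon
    push Not at hcon
    apply hpq
    have hle : ∀ l ∈ Finset.univ, q l ≤ p l := by
      intro l _
      have := hcon.trans (hj l)
      rwa [one_le_div (hq l)] at this
    have := (Finset.sum_eq_sum_iff_of_le hle).1 (hqs.trans hps.symm)
    funext l; exact (this l (Finset.mem_univ _)).symm
  have hr0 : 0 < p j / q j := div_pos (hp j) (hq j)
  have hT : {t : ℝ | W p + t • (W q - W p) ∈ O} =
      Set.Ioo (-((p j / q j) / (1 - p j / q j))) ((p i / q i) / (p i / q i - 1)) := by
    have key : ∀ t : ℝ, W p + t • (W q - W p) ∈ O ↔ ∀ l, 0 < p l + t * (q l - p l) := by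
      intro t
      have e : W p + t • (W q - W p) = W (p + t • (q - p)) := by simp
      have es : ∑ l, (p + t • (q - p)) l = 1 := by
        simp only [Pi.add_apply, Pi.smul_apply, Pi.sub_apply, smul_eq_mul,
          Finset.sum_add_distrib, ← Finset.mul_sum, Finset.sum_sub_distrib, hps, hqs]
        ring
      rw [e]
      constructor
      · intro hmem
        by_contra hcon
        push Not at hcon
        obtain ⟨s, hs0, hs1, hnn, l, hl⟩ := exit_aux p (p + t • (q - p)) hp hcon
        have := h2 ((1 - s) • p + s • (p + t • (q - p))) hnn (by
          have : ∑ l, ((1 - s) • p + s • (p + t • (q - p))) l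
            = (1 - s) * ∑ l, p l + s * ∑ l, (p + t • (q - p)) l := by
            rw [Finset.mul_sum, Finset.mul_sum, ← Finset.sum_add_distrib]; rfl
          rw [this, es, hps]; ring) (by
          rw [map_add, map_smul, map_smul]
          exact hO (h1 p hp hps) hmem (by linarith) hs0 (by ring)) l
        have h0 : ((1 - s) • p + s • (p + t • (q - p))) l = 0 := hl
        linarith
      · intro h
        exact h1 _ h es
    ext t
    rw [Set.mem_ofPred_eq, key, Set.mem_Ioo]
    have conv : ∀ l, p l + t * (q l - p l) = q l * (t + (1 - t) * (p l / q l)) := by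
      intro l; field_simp [(hq l).ne']; ring
    have hA : t < (p i / q i) / (p i / q i - 1) ↔ 0 < t + (1 - t) * (p i / q i) := by
      rw [lt_div_iff₀ (by linarith)]; constructor <;> intro h <;> nlinarith
    have hB : -((p j / q j) / (1 - p j / q j)) < t ↔ 0 < t + (1 - t) * (p j / q j) := by
      rw [neg_lt, lt_div_iff₀ (by linarith)] 
      constructor <;> intro h <;> nlinarith
    rw [hA, hB]
    constructor
    · intro h
      have a := h i; have b := h j
      rw [conv] at a b
      exact ⟨pos_of_mul_pos_right b (hq j).le, pos_of_mul_pos_right a (hq i).le⟩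
    · rintro ⟨b, a⟩ l
      rw [conv]
      apply mul_pos (hq l)
      have ha := hi l
      have hb := hj l
      rcases le_total t 1 with ht | ht
      · nlinarith [mul_le_mul_of_nonneg_left hb (sub_nonneg.2 ht)]
      · nlinarith [mul_le_mul_of_nonneg_left ha (sub_nonneg.2 ht)]
  rw [hilbertDistChart, if_neg hWne, hT]
  have hlt : -((p j / q j) / (1 - p j / q j)) < (p i / q i) / (p i / q i - 1) := by
    have : 0 < (p j / q j) / (1 - p j / q j) := div_pos hr0 (by linarith)
    have : 0 < (p i / q i) / (p i / q i - 1) := div_pos (by linarith) (by linarith)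
    linarith
  rw [csSup_Ioo hlt, csInf_Ioo hlt]
  congr 2
  generalize p i / q i = R at *
  generalize p j / q j = r at *
  have a1 : R - 1 ≠ 0 := by linarith
  have a2 : 1 - r ≠ 0 := by linarith
  have a3 : r ≠ 0 := hr0.ne'
  have e1 : R / (R - 1) - 1 = 1 / (R - 1) := by field_simp; ring
  have e2 : 1 - -(r / (1 - r)) = 1 / (1 - r) := by field_simp; ring
  rw [e1, e2, neg_neg]
  field_simp

lemma chartMap_mk (F : (Fin d → ℝ) →ₗ[ℝ] ℝ) (v : Fin d → ℝ) (hv : v ≠ 0) :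
    chartMap F (Projectivization.mk ℝ v hv) = (F v)⁻¹ • v := by
  obtain ⟨a, ha⟩ := Projectivization.exists_smul_eq_mk_rep ℝ v hv
  have ha0 : (a : ℝ) ≠ 0 := a.ne_zero
  rw [chartMap, ← ha, Units.smul_def, map_smul, smul_smul, smul_eq_mul, mul_inv]
  congr 1
  field_simp

lemma rep_ne (F : (Fin d → ℝ) →ₗ[ℝ] ℝ) (v : Fin d → ℝ) (hv : v ≠ 0)
    (h : F (Projectivization.mk ℝ v hv).rep ≠ 0) : F v ≠ 0 := by
  obtain ⟨a, ha⟩ := Projectivization.exists_smul_eq_mk_rep ℝ v hv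
  rw [← ha, Units.smul_def, map_smul] at h
  intro h0; apply h; rw [h0]; simp

lemma mk_continuous : Continuous (fun v : {v : Fin d → ℝ // v ≠ 0} =>
    (Projectivization.mk ℝ v.1 v.2 : PSpace d)) :=
  continuous_quot_mk

lemma simplex_param {k : ℕ} (S : Set (PSpace d)) (hS : IsSimplexOfDim k S) :
    ∃ G : (Fin (k+1) → ℝ) →ₗ[ℝ] (Fin d → ℝ), Function.Injective G ∧
      ∀ q, q ∈ S ↔ ∃ p : Fin (k+1) → ℝ, (∀ i, 0 < p i) ∧ ∃ h : G p ≠ 0,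
        q = Projectivization.mk ℝ (G p) h := by
  obtain ⟨hk, g, rfl⟩ := hS
  let J : (Fin (k+1) → ℝ) →ₗ[ℝ] (Fin d → ℝ) :=
    { toFun := fun p i => if h : (i : ℕ) < k + 1 then p ⟨i, h⟩ else 0
      map_add' := by
        intro x y; ext i
        by_cases h : (i : ℕ) < k + 1 <;> simp only [h, dite_true, dite_false, Pi.add_apply, Pi.smul_apply, smul_eq_mul, add_zero, mul_zero, RingHom.id_apply]
      map_smul' := by
        intro x y; ext i
        by_cases h : (i : ℕ) < k + 1 <;> simp only [h, dite_true, dite_false, Pi.add_apply, Pi.smul_apply, smul_eq_mul, add_zero, mul_zero, RingHom.id_apply] }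
  have hJ : ∀ p i, J p i = if h : (i : ℕ) < k + 1 then p ⟨i, h⟩ else 0 := fun _ _ => rfl
  have hJc : ∀ p (i : Fin (k+1)), J p (Fin.castLE hk i) = p i := by
    intro p i; rw [hJ, dif_pos (show ((Fin.castLE hk i : Fin d) : ℕ) < k + 1 from i.2)]; rfl
  refine ⟨g.toLinearMap ∘ₗ J, ?_, ?_⟩
  · rw [LinearMap.coe_comp]
    refine g.injective.comp ?_
    intro x y hxy
    ext i
    rw [← hJc x, hxy, hJc]
  · intro q
    constructor
    · rintro ⟨v, ⟨hv1, hv2⟩, hv, rfl⟩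
      have : J (fun i => v (Fin.castLE hk i)) = v := by
        ext i
        rw [hJ]
        split_ifs with h
        · rfl
        · exact (hv2 i (by omega)).symm
      refine ⟨fun i => v (Fin.castLE hk i), fun i => hv1 _ i.2, ?_, ?_⟩
      · simp [this, hv]
      · simp [this]
    · rintro ⟨p, hp, h, rfl⟩
      refine ⟨J p, ⟨?_, ?_⟩, ?_, rfl⟩
      · intro i hi; rw [hJ, dif_pos hi]; exact hp _
      · intro i hi; rw [hJ, dif_neg (by omega)]
      · intro h0; apply h; simp [h0]

lemma mem_closure_simplex {k : ℕ} (S : Set (PSpace d))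
    (G : (Fin (k+1) → ℝ) →ₗ[ℝ] (Fin d → ℝ)) (hG : Function.Injective G)
    (hS : ∀ q, q ∈ S ↔ ∃ p : Fin (k+1) → ℝ, (∀ i, 0 < p i) ∧ ∃ h : G p ≠ 0,
        q = Projectivization.mk ℝ (G p) h)
    (p : Fin (k+1) → ℝ) (hp : ∀ i, 0 ≤ p i) (h : G p ≠ 0) :
    Projectivization.mk ℝ (G p) h ∈ closure S := by
  have hpos : ∀ n : ℕ, ∀ i, 0 < p i + 1 / ((n : ℝ) + 1) := by
    intro n i; have := hp i; positivity
  have hne : ∀ n : ℕ, G (fun i => p i + 1 / ((n : ℝ) + 1)) ≠ 0 := by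
    intro n h0
    have := hG (h0.trans (map_zero G).symm)
    have h1 := congrFun this 0
    exact (hpos n 0).ne' h1
  have hc : Tendsto (fun n : ℕ => (⟨G (fun i => p i + 1 / ((n : ℝ) + 1)), hne n⟩ :
      {v : Fin d → ℝ // v ≠ 0})) atTop (nhds ⟨G p, h⟩) := by
    rw [tendsto_subtype_rng]
    have hGc : Continuous G := G.continuous_of_finiteDimensional
    refine (hGc.tendsto p).comp ?_
    rw [tendsto_pi_nhds]
    intro i
    simpa using (tendsto_one_div_add_atTop_nhds_zero_nat (𝕜 := ℝ)).const_add (p i)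
  refine mem_closure_of_tendsto ((mk_continuous.tendsto _).comp hc) (Eventually.of_forall ?_)
  intro n
  exact (hS _).2 ⟨_, hpos n, hne n, rfl⟩

lemma simplex_chart {k : ℕ} (Ω S : Set (PSpace d))
    (hΩ : IsPCDomain Ω) (hS : IsSimplexOfDim k S) (hSsub : S ⊆ Ω)
    (hSpe : IsProperlyEmbedded S Ω) :
    ∃ W : (Fin (k+1) → ℝ) →ₗ[ℝ] (Fin d → ℝ), Function.Injective W ∧
      (∀ q ∈ S, ∃ p : Fin (k+1) → ℝ,
        (∀ i, 0 < p i) ∧ ∑ i, p i = 1 ∧ cmap Ω q = W p) ∧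
      (∀ p : Fin (k+1) → ℝ, (∀ i, 0 < p i) → ∑ i, p i = 1 → ∃ q ∈ S, cmap Ω q = W p) ∧
      (∀ p : Fin (k+1) → ℝ, (∀ i, 0 ≤ p i) → ∑ i, p i = 1 → W p ∈ cmap Ω '' Ω →
        ∀ i, 0 < p i) ∧ Convex ℝ (cmap Ω '' Ω) := by
  obtain ⟨G, hG, hSG⟩ := simplex_param S hS
  have hpc := hΩ.2.2
  have hF : (∀ x ∈ closure Ω, chartOf Ω x.rep ≠ 0) ∧
    Convex ℝ (chartMap (chartOf Ω) '' Ω) ∧ Bornology.IsBounded (chartMap (chartOf Ω) '' Ω) := by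
    rw [chartOf, dif_pos hpc]; exact hpc.choose_spec
  unfold cmap
  generalize chartOf Ω = F at *
  obtain ⟨hF1, hF2, -⟩ := hF
  have hGne : ∀ p, p ≠ 0 → G p ≠ 0 := fun p hp h0 => hp (hG (h0.trans (map_zero G).symm))
  have hFG : ∀ p : Fin (k+1) → ℝ, (∀ i, 0 ≤ p i) → p ≠ 0 → F (G p) ≠ 0 := by
    intro p hp hp0
    exact rep_ne F _ (hGne p hp0) (hF1 _ (closure_mono hSsub
      (mem_closure_simplex S G hG hSG p hp (hGne p hp0))))
  set c : Fin (k+1) → ℝ := fun i => F (G (Pi.single i 1)) with hc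
  have hc0 : ∀ i, c i ≠ 0 := by
    intro i
    refine hFG _ ?_ ?_
    · intro j; by_cases h : j = i
      · subst h; simp
      · simp [h]
    · simp
  have hsum : ∀ p : Fin (k+1) → ℝ, F (G p) = ∑ i, c i * p i := by
    intro p
    conv_lhs => rw [pi_eq_sum_univ' p]
    rw [map_sum, map_sum]
    refine Finset.sum_congr rfl fun i _ => ?_
    rw [map_smul, map_smul, smul_eq_mul, mul_comm]
  have hcc : ∀ i j, 0 < c i * c j := by
    intro i j
    by_contra hcon
    have hlt : c i * c j < 0 := lt_of_le_of_ne (not_lt.1 hcon) (mul_ne_zero (hc0 i) (hc0 j))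
    refine hFG (|c j| • Pi.single i 1 + |c i| • Pi.single j 1) ?_ ?_ ?_
    · intro l
      have : ∀ a : Fin (k+1), 0 ≤ (Pi.single a (1:ℝ) : Fin (k+1) → ℝ) l := by
        intro a; by_cases h : l = a
        · subst h; simp
        · simp [h]
      have h1 := this i
      have h2 := this j
      simp only [Pi.add_apply, Pi.smul_apply, smul_eq_mul]
      positivity
    · intro h0
      have h1 := congrFun h0 i
      have hij : i ≠ j := by
        rintro rfl; nlinarith [mul_self_nonneg (c i)]
      simp [hij, hc0 j] at h1
    · simp only [map_add, map_smul, smul_eq_mul]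
      change |c j| * c i + |c i| * c j = 0
      rcases mul_neg_iff.1 hlt with ⟨a, b⟩ | ⟨a, b⟩
      · rw [abs_of_pos a, abs_of_neg b]; ring
      · rw [abs_of_neg a, abs_of_pos b]; ring
  let D : (Fin (k+1) → ℝ) →ₗ[ℝ] (Fin (k+1) → ℝ) :=
    { toFun := fun p i => p i / c i
      map_add' := by intro x y; ext i; simp [add_div]
      map_smul' := by intro x y; ext i; simp [mul_div_assoc] }
  have hD : ∀ p i, D p i = p i / c i := fun _ _ => rfl
  have hFW : ∀ p, F (G (D p)) = ∑ i, p i := by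
    intro p
    rw [hsum]
    refine Finset.sum_congr rfl fun i _ => ?_
    rw [hD, mul_div_cancel₀ _ (hc0 i)]
  have hDinj : Function.Injective D := by
    intro x y hxy
    ext i
    have := congrFun hxy i
    rw [hD, hD] at this
    exact (div_left_inj' (hc0 i)).1 this
  have hS1 : ∀ p : Fin (k+1) → ℝ, (∀ i, 0 < p i) → F (G p) ≠ 0 ∧
      ∀ i, 0 < c i * ((F (G p))⁻¹ * p i) := by
    intro p hp
    have hne : F (G p) ≠ 0 := hFG p (fun i => (hp i).le) (fun h => (hp 0).ne' (congrFun h 0))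
    refine ⟨hne, fun i => ?_⟩
    have : 0 < c i * F (G p) := by
      rw [hsum, Finset.mul_sum]
      refine Finset.sum_pos (fun l _ => ?_) ⟨0, Finset.mem_univ _⟩
      rw [← mul_assoc]; exact mul_pos (hcc i l) (hp l)
    have h2 : c i * ((F (G p))⁻¹ * p i) = (c i * F (G p)) * p i * ((F (G p))⁻¹)^2 := by
      field_simp
    rw [h2]
    have := hp i
    positivity
  refine ⟨G ∘ₗ D, ?_, ?_, ?_, ?_, hF2⟩
  · rw [LinearMap.coe_comp]; exact hG.comp hDinj
  · intro q hq
    obtain ⟨p, hp, h, rfl⟩ := (hSG q).1 hq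
    obtain ⟨hne, hpos⟩ := hS1 p hp
    have hDe : D (fun i => c i * ((F (G p))⁻¹ * p i)) = (F (G p))⁻¹ • p := by
      ext i; rw [hD, mul_div_cancel_left₀ _ (hc0 i)]; rfl
    refine ⟨fun i => c i * ((F (G p))⁻¹ * p i), hpos, ?_, ?_⟩
    · rw [← hFW, hDe, map_smul, map_smul, smul_eq_mul, inv_mul_cancel₀ hne]
    · rw [chartMap_mk, LinearMap.comp_apply, hDe, map_smul]
  · intro p hp hps
    have hpos : ∀ i, 0 < p i / |c i| := fun i => div_pos (hp i) (abs_pos.2 (hc0 i))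
    have hne0 : G (fun i => p i / |c i|) ≠ 0 :=
      hGne _ (fun h => (hpos 0).ne' (congrFun h 0))
    refine ⟨_, (hSG _).2 ⟨fun i => p i / |c i|, hpos, hne0, rfl⟩, ?_⟩
    rw [chartMap_mk, LinearMap.comp_apply]
    have : ∃ e : ℝ, e ≠ 0 ∧ (fun i => p i / |c i|) = e • D p := by
      rcases lt_or_gt_of_ne (hc0 0) with h | h
      · refine ⟨-1, by norm_num, ?_⟩
        ext i
        have : c i < 0 := by nlinarith [hcc 0 i]
        rw [abs_of_neg this, Pi.smul_apply, hD, smul_eq_mul, div_neg]; ring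
      · refine ⟨1, by norm_num, ?_⟩
        ext i
        have : 0 < c i := by nlinarith [hcc 0 i]
        rw [abs_of_pos this, Pi.smul_apply, hD, smul_eq_mul, one_mul]
    obtain ⟨e, he, hee⟩ := this
    rw [hee, map_smul, map_smul, hFW, hps, smul_smul]
    simp [he]
  · rintro p hp hps ⟨x, hx, hxp⟩ i
    rw [LinearMap.comp_apply] at hxp
    have hcp : (∀ l, 0 ≤ p l / |c l|) := fun l => div_nonneg (hp l) (abs_nonneg _)
    have hp0 : p ≠ 0 := by rintro rfl; simp at hps
    have hDp : D p ≠ 0 := fun h0 => hp0 (hDinj (h0.trans (map_zero D).symm))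
    have : ∃ e : ℝ, e ≠ 0 ∧ (fun i => p i / |c i|) = e • D p := by
      rcases lt_or_gt_of_ne (hc0 0) with h | h
      · refine ⟨-1, by norm_num, ?_⟩
        ext i
        have : c i < 0 := by nlinarith [hcc 0 i]
        rw [abs_of_neg this, Pi.smul_apply, hD, smul_eq_mul, div_neg]; ring
      · refine ⟨1, by norm_num, ?_⟩
        ext i
        have : 0 < c i := by nlinarith [hcc 0 i]
        rw [abs_of_pos this, Pi.smul_apply, hD, smul_eq_mul, one_mul]
    obtain ⟨e, he, hee⟩ := this
    have hG1 : G (fun i => p i / |c i|) ≠ 0 := by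
      rw [hee]; exact hGne _ (smul_ne_zero he hDp)
    have hxm : x = Projectivization.mk ℝ (G (fun i => p i / |c i|)) hG1 := by
      have hxr : F x.rep ≠ 0 := hF1 x (subset_closure hx)
      conv_lhs => rw [← x.mk_rep]
      rw [Projectivization.mk_eq_mk_iff']
      refine ⟨F x.rep * e⁻¹, ?_⟩
      rw [hee, map_smul, ← hxp, chartMap, smul_smul, smul_smul]
      rw [mul_assoc (F x.rep), inv_mul_cancel₀ he, mul_one, mul_inv_cancel₀ hxr, one_smul]
    have hxc : x ∈ closure S := by
      rw [hxm]; exact mem_closure_simplex S G hG hSG _ hcp hG1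
    have hxS : x ∈ S := by
      obtain ⟨h, hprop⟩ := hSpe
      have hcl : IsClosed (Set.range (Set.inclusion h)) := hprop.isClosedMap.isClosed_range
      rw [Set.range_inclusion] at hcl
      obtain ⟨K, hK, hKe⟩ := isClosed_induced_iff.1 hcl
      have hSK : S ⊆ K := by
        intro s hs
        have : (⟨s, h hs⟩ : Ω) ∈ Subtype.val ⁻¹' K := by rw [hKe]; exact hs
        exact this
      have hxK : x ∈ K := closure_minimal hSK hK hxc
      have : (⟨x, hx⟩ : Ω) ∈ Subtype.val ⁻¹' K := hxK
      rw [hKe] at this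
      exact this
    obtain ⟨q, hq, hq0, hxq⟩ := (hSG x).1 hxS
    have hm : G (D p) = G ((F (G q))⁻¹ • q) := by
      rw [← hxp, hxq, chartMap_mk, map_smul]
    have hm2 := congrFun (hG hm) i
    rw [hD, Pi.smul_apply, smul_eq_mul] at hm2
    have h3 := (hS1 q hq).2 i
    rw [← hm2, mul_div_cancel₀ _ (hc0 i)] at h3
    exact h3

/-- coordinates extended by a zero -/
def ext0 {k : ℕ} (u : Fin k → ℝ) : Fin (k+1) → ℝ := Fin.snoc u 0

/-- softmax -/
def smax {k : ℕ} (u : Fin k → ℝ) (i : Fin (k+1)) : ℝ :=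
  Real.exp (ext0 u i) / ∑ j, Real.exp (ext0 u j)

lemma expsum_pos {k : ℕ} (u : Fin k → ℝ) : 0 < ∑ j, Real.exp (ext0 u j) :=
  Finset.sum_pos (fun _ _ => Real.exp_pos _) ⟨0, Finset.mem_univ _⟩

lemma smax_pos {k : ℕ} (u : Fin k → ℝ) (i) : 0 < smax u i :=
  div_pos (Real.exp_pos _) (expsum_pos u)

lemma smax_sum {k : ℕ} (u : Fin k → ℝ) : ∑ i, smax u i = 1 := by
  unfold smax
  rw [← Finset.sum_div, div_self (expsum_pos u).ne']

lemma log_smax {k : ℕ} (u : Fin k → ℝ) (i) :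
    Real.log (smax u i) = ext0 u i - Real.log (∑ j, Real.exp (ext0 u j)) := by
  rw [smax, Real.log_div (Real.exp_pos _).ne' (expsum_pos u).ne', Real.log_exp]

lemma smax_surj {k : ℕ} (p : Fin (k+1) → ℝ) (hp : ∀ i, 0 < p i) (hps : ∑ i, p i = 1) :
    smax (fun i : Fin k => Real.log (p i.castSucc / p (Fin.last k))) = p := by
  have h : ∀ i, Real.exp (ext0 (fun i : Fin k => Real.log (p i.castSucc / p (Fin.last k))) i)
      = p i / p (Fin.last k) := by
    intro i
    refine Fin.lastCases ?_ (fun j => ?_) i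
    · simp [ext0, div_self (hp (Fin.last k)).ne']
    · simp only [ext0, Fin.snoc_castSucc]
      rw [Real.exp_log (div_pos (hp _) (hp _))]
  ext i
  simp only [smax, h]
  rw [← Finset.sum_div, hps]
  have := (hp (Fin.last k)).ne'
  field_simp

/-- Proposition 2.7: a properly embedded simplex of dimension `k` in `Ω` is
quasi-isometric to `ℝ^k` with respect to the Hilbert metric. -/
theorem simplex_quasi_isometric_to_euclidean {d k : ℕ} (Ω S : Set (PSpace d))
    (hΩ : IsPCDomain Ω) (hS : IsSimplexOfDim k S) (hSsub : S ⊆ Ω)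
    (hSpe : IsProperlyEmbedded S Ω) :
    ∃ A B : ℝ, 1 ≤ A ∧ 0 ≤ B ∧ ∃ f : EuclideanSpace ℝ (Fin k) → PSpace d,
      (∀ u, f u ∈ S) ∧
      (∀ u v : EuclideanSpace ℝ (Fin k),
        (1 / A) * dist u v - B ≤ hilbertDist Ω (f u) (f v) ∧
        hilbertDist Ω (f u) (f v) ≤ A * dist u v + B) ∧
      ∀ s ∈ S, ∃ u : EuclideanSpace ℝ (Fin k), hilbertDist Ω s (f u) ≤ B := by

  obtain ⟨W, hW, hW1, hW2, hW3, hconv⟩ := simplex_chart Ω S hΩ hS hSsub hSpe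
  have hex : ∀ u : EuclideanSpace ℝ (Fin k), ∃ q ∈ S, cmap Ω q = W (smax (fun i => u i)) :=
    fun u => hW2 _ (smax_pos _) (smax_sum _)
  choose f hfS hf using hex
  have hin : ∀ p : Fin (k+1) → ℝ, (∀ i, 0 < p i) → ∑ i, p i = 1 → W p ∈ cmap Ω '' Ω := by
    intro p hp hps
    obtain ⟨q, hq, hqe⟩ := hW2 p hp hps
    exact ⟨q, hSsub hq, hqe⟩
  refine ⟨2 * k + 1, 0, by linarith [(Nat.cast_nonneg k : (0:ℝ) ≤ k)], le_rfl, f, hfS, ?_, ?_⟩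
  · intro u v
    obtain ⟨i, j, hi, hj, hh⟩ := hilb_formula (cmap Ω '' Ω) hconv W hW hin hW3
      (smax (fun i => u i)) (smax (fun i => v i)) (smax_pos _) (smax_pos _)
      (smax_sum _) (smax_sum _)
    rw [← hf u, ← hf v] at hh
    change hilbertDist Ω (f u) (f v) = _ at hh
    rw [hh]
    clear hh
    set U := ext0 (fun i => u i) with hU
    set V := ext0 (fun i => v i) with hV
    set K := Real.log (∑ j, Real.exp (U j)) - Real.log (∑ j, Real.exp (V j)) with hK
    have hlog : ∀ l, Real.log (smax (fun i => u i) l / smax (fun i => v i) l) = U l - V l - K := by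
      intro l
      rw [Real.log_div (smax_pos _ _).ne' (smax_pos _ _).ne', log_smax, log_smax]
      ring
    have hrpos : ∀ l, 0 < smax (fun i => u i) l / smax (fun i => v i) l :=
      fun l => div_pos (smax_pos _ _) (smax_pos _ _)
    have hi' : ∀ l, U l - V l ≤ U i - V i := by
      intro l
      have := Real.log_le_log (hrpos l) (hi l)
      rw [hlog, hlog] at this
      linarith
    have hj' : ∀ l, U j - V j ≤ U l - V l := by
      intro l
      have := Real.log_le_log (hrpos j) (hj l)
      rw [hlog, hlog] at this
      linarith
    rw [Real.log_div (hrpos i).ne' (hrpos j).ne', hlog, hlog]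
    have hcast : ∀ l : Fin k, U l.castSucc - V l.castSucc = u l - v l := by
      intro l; simp [hU, hV, ext0]
    have hlast : U (Fin.last k) - V (Fin.last k) = 0 := by simp [hU, hV, ext0]
    have hcoord : ∀ l : Fin k, |u l - v l| ≤ dist u v := by
      intro l
      rw [dist_eq_norm]
      exact PiLp.norm_apply_le (u - v) l
    have habs : ∀ l, |U l - V l| ≤ dist u v := by
      intro l
      refine Fin.lastCases ?_ (fun l => ?_) l
      · rw [hlast]; simp
      · rw [hcast]; exact hcoord l
    constructor
    · set h := 1 / 2 * (U i - V i - K - (U j - V j - K)) with hh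
      have h0 : 0 ≤ h := by rw [hh]; linarith [hi' j]
      have hb : ∀ l : Fin k, |u l - v l| ≤ 2 * h := by
        intro l
        rw [← hcast, abs_le, hh]
        have a1 := hi' l.castSucc
        have a2 := hj' l.castSucc
        have a3 := hi' (Fin.last k)
        have a4 := hj' (Fin.last k)
        constructor <;> linarith
      have hd : dist u v ≤ (2 * k) * h := by
        rw [EuclideanSpace.dist_eq]
        apply Real.sqrt_le_iff.2 ⟨by positivity, ?_⟩
        have h1 : ∑ l, dist (u l) (v l) ^ 2 ≤ ∑ _l : Fin k, (2 * h) ^ 2 := by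
          refine Finset.sum_le_sum fun l _ => ?_
          rw [Real.dist_eq]
          exact pow_le_pow_left₀ (abs_nonneg _) (hb l) 2
        refine h1.trans ?_
        rw [Finset.sum_const, Finset.card_univ, Fintype.card_fin, nsmul_eq_mul]
        have hk : (k : ℝ) ≤ (k : ℝ) ^ 2 := by exact_mod_cast Nat.le_self_pow two_ne_zero k
        nlinarith [mul_le_mul_of_nonneg_right hk (sq_nonneg (2 * h))]
      rw [sub_zero, one_div, inv_mul_le_iff₀ (by positivity)]
      linarith
    · have a1 := abs_le.1 (habs i)
      have a2 := abs_le.1 (habs j)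
      have : 0 ≤ (k : ℝ) * dist u v := by positivity
      nlinarith [a1.1, a1.2, a2.1, a2.2]
  · intro s hs
    obtain ⟨p, hp, hps, hsp⟩ := hW1 s hs
    refine ⟨WithLp.toLp 2 (fun i : Fin k => Real.log (p i.castSucc / p (Fin.last k))), ?_⟩
    have : cmap Ω (f (WithLp.toLp 2 (fun i : Fin k => Real.log (p i.castSucc / p (Fin.last k)))))
        = cmap Ω s := by
      rw [hf, hsp]
      congr 1
      exact smax_surj p hp hps
    rw [hilbertDist, this, hilbertDistChart, if_pos rfl]

end Paper
end
end

section
/- Let Ω ⊂ P(ℝ^d) be a properly convex domain and let S ⊂ Ω be a properly embedded simplex. If x ∈ ∂S, then the face F_S(x) of x in S is a properly embedded simplex in the face F_Ω(x), and F_S(x) = closure(S) ∩ F_Ω(x). -/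
open Set Filter

noncomputable section

namespace Paper

variable {d : ℕ}

/-- `x` is the class of `v`. -/
def Cls (v : Fin d → ℝ) (x : PSpace d) : Prop := ∃ h : v ≠ 0, x = Projectivization.mk ℝ v h

lemma Cls.smul {v : Fin d → ℝ} {x : PSpace d} (h : Cls v x) {c : ℝ} (hc : c ≠ 0) :
    Cls (c • v) x := by
  obtain ⟨h0, rfl⟩ := h
  refine ⟨smul_ne_zero hc h0, ?_⟩
  rw [Projectivization.mk_eq_mk_iff']
  exact ⟨c⁻¹, by rw [smul_smul, inv_mul_cancel₀ hc, one_smul]⟩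

lemma Cls.inj {v w : Fin d → ℝ} {x : PSpace d} (h : Cls v x) (h' : Cls w x) :
    ∃ c : ℝ, c ≠ 0 ∧ w = c • v := by
  obtain ⟨h0, rfl⟩ := h
  obtain ⟨h1, e⟩ := h'
  rw [eq_comm, Projectivization.mk_eq_mk_iff'] at e
  obtain ⟨a, ha⟩ := e
  refine ⟨a, ?_, ha.symm⟩
  rintro rfl
  simp at ha
  exact h1 ha.symm

lemma Cls.eq {v : Fin d → ℝ} {x y : PSpace d} (h : Cls v x) (h' : Cls v y) : x = y := by
  obtain ⟨h0, rfl⟩ := h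
  obtain ⟨h1, rfl⟩ := h'
  rfl

lemma cls_rep (x : PSpace d) : Cls x.rep x := ⟨x.rep_nonzero, x.mk_rep.symm⟩

lemma Cls.chart {v : Fin d → ℝ} {x : PSpace d} (h : Cls v x) (f : (Fin d → ℝ) →ₗ[ℝ] ℝ) :
    chartMap f x = (f v)⁻¹ • v := by
  obtain ⟨c, hc, e⟩ := h.inj (cls_rep x)
  unfold chartMap
  rw [e, map_smul, smul_smul, smul_eq_mul, mul_inv, mul_comm, ← mul_assoc, mul_inv_cancel₀ hc,
    one_mul]

lemma Cls.ne_iff {v : Fin d → ℝ} {x : PSpace d} (h : Cls v x) (f : (Fin d → ℝ) →ₗ[ℝ] ℝ) :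
    f x.rep ≠ 0 ↔ f v ≠ 0 := by
  obtain ⟨c, hc, e⟩ := h.inj (cls_rep x)
  rw [e, map_smul, smul_eq_mul]
  simp [hc]

lemma isOpen_iff_lift (U : Set (PSpace d)) :
    IsOpen U ↔ IsOpen {v : {v : Fin d → ℝ // v ≠ 0} | Projectivization.mk ℝ v.1 v.2 ∈ U} :=
  isQuotientMap_quot_mk.isOpen_preimage.symm

lemma isOpen_lift {U : Set (PSpace d)} (hU : IsOpen U) :
    IsOpen {v : Fin d → ℝ | ∃ x ∈ U, Cls v x} := by
  have h := (isOpen_iff_lift U).1 hU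
  have h0 : IsOpen {v : Fin d → ℝ | v ≠ 0} := isOpen_ne
  have := h0.isOpenMap_subtype_val _ h
  convert this using 1
  ext v
  constructor
  · rintro ⟨x, hx, h, rfl⟩
    exact ⟨⟨v, h⟩, hx, rfl⟩
  · rintro ⟨w, hw, rfl⟩
    exact ⟨_, hw, w.2, rfl⟩

/-- closedness of images of closed scaling-invariant sets -/
lemma isClosed_cls {A : Set (Fin d → ℝ)} (hA : IsClosed A) (hs : ∀ c : ℝ, c ≠ 0 → ∀ v ∈ A, c • v ∈ A) :
    IsClosed {x : PSpace d | ∃ v ∈ A, Cls v x} := by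
  rw [← isOpen_compl_iff, isOpen_iff_lift]
  have : IsOpen {v : {v : Fin d → ℝ // v ≠ 0} | v.1 ∉ A} :=
    hA.isOpen_compl.preimage continuous_subtype_val
  convert this using 1
  ext v
  simp only [mem_compl_iff, mem_ofPred_eq, not_iff_not]
  constructor
  · rintro ⟨w, hw, hc⟩
    obtain ⟨c, hc, e⟩ := hc.inj ⟨v.2, rfl⟩
    rw [e]; exact hs c hc w hw
  · intro h
    exact ⟨_, h, v.2, rfl⟩

lemma cls_closure {A : Set (Fin d → ℝ)} {v : Fin d → ℝ} (hv : v ∈ closure A) {x : PSpace d}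
    (hx : Cls v x) {C : Set (PSpace d)} (hC : ∀ w ∈ A, ∀ y, Cls w y → y ∈ C) : x ∈ closure C := by
  rw [mem_closure_iff]
  intro U hU hxU
  obtain ⟨w, ⟨y, hy, hwy⟩, hwA⟩ := mem_closure_iff.1 hv _ (isOpen_lift hU) ⟨x, hxU, hx⟩
  exact ⟨y, hy, hC w hwA y hwy⟩

/-- The open cone over a set. -/
def coneOver (f : (Fin d → ℝ) →ₗ[ℝ] ℝ) (Ω : Set (PSpace d)) : Set (Fin d → ℝ) :=
  {v | 0 < f v ∧ ∃ x ∈ Ω, Cls v x}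

lemma coneOver_open (f : (Fin d → ℝ) →ₗ[ℝ] ℝ) {Ω : Set (PSpace d)} (h : IsOpen Ω) :
    IsOpen (coneOver f Ω) :=
  (isOpen_lt continuous_const f.continuous_of_finiteDimensional).inter (isOpen_lift h)

lemma coneOver_convex (f : (Fin d → ℝ) →ₗ[ℝ] ℝ) {Ω : Set (PSpace d)}
    (hf : ∀ x ∈ Ω, f x.rep ≠ 0) (h : Convex ℝ (chartMap f '' Ω)) :
    Convex ℝ (coneOver f Ω) := by
  rw [convex_iff_forall_pos]
  rintro u ⟨hu, x, hx, hux⟩ v ⟨hv, y, hy, hvy⟩ a b ha hb hab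
  have hpos : 0 < f (a • u + b • v) := by simp; positivity
  refine ⟨hpos, ?_⟩
  set s := f (a • u + b • v) with hs
  have hs' : s = a * f u + b * f v := by simp [hs]
  obtain ⟨z, hz, e⟩ := h ⟨x, hx, rfl⟩ ⟨y, hy, rfl⟩ (a := a * f u / s) (b := b * f v / s)
    (by positivity) (by positivity) (by rw [← add_div, ← hs', div_self hpos.ne'])
  refine ⟨z, hz, ?_⟩
  rw [hux.chart, hvy.chart, smul_smul, smul_smul] at e
  have h1 : a * f u / s * (f u)⁻¹ = s⁻¹ * a := by field_simp
  have h2 : b * f v / s * (f v)⁻¹ = s⁻¹ * b := by field_simp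
  rw [h1, h2, mul_smul, mul_smul, ← smul_add] at e
  have h3 : Cls (chartMap f z) z := (cls_rep z).smul (inv_ne_zero (hf z hz))
  rw [e] at h3
  have := h3.smul hpos.ne'
  rwa [smul_smul, mul_inv_cancel₀ hpos.ne', one_smul] at this

lemma mem_closure_coneOver (f : (Fin d → ℝ) →ₗ[ℝ] ℝ) {Ω : Set (PSpace d)} {x : PSpace d}
    (hx : x ∈ closure Ω) {u : Fin d → ℝ} (hu : 0 < f u) (hux : Cls u x) :
    u ∈ closure (coneOver f Ω) := by
  rw [mem_closure_iff]
  intro N hN huN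
  have hN' : IsOpen (N ∩ {v | 0 < f v}) :=
    hN.inter (isOpen_lt continuous_const f.continuous_of_finiteDimensional)
  have hV : IsOpen {y : PSpace d | ∃ v ∈ N ∩ {v | 0 < f v}, Cls v y} := by
    rw [isOpen_iff_lift]
    have : IsOpen {v : {v : Fin d → ℝ // v ≠ 0} | ∃ c : ℝ, c ≠ 0 ∧ c • v.1 ∈ N ∩ {v | 0 < f v}} := by
      have e : {v : {v : Fin d → ℝ // v ≠ 0} | ∃ c : ℝ, c ≠ 0 ∧ c • v.1 ∈ N ∩ {v | 0 < f v}} =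
        ⋃ c : ℝ, ⋃ _ : c ≠ 0, (fun v : {v : Fin d → ℝ // v ≠ 0} => c • v.1) ⁻¹' (N ∩ {v | 0 < f v}) := by
        ext v; simp only [mem_ofPred_eq, mem_iUnion, mem_preimage, exists_prop]
      rw [e]
      exact isOpen_iUnion fun c => isOpen_iUnion fun _ => hN'.preimage (by fun_prop)
    convert this using 1
    ext v
    constructor
    · rintro ⟨w, hw, hwv⟩
      obtain ⟨c, hc, e⟩ := Cls.inj (v := v.1) ⟨v.2, rfl⟩ hwv
      exact ⟨c, hc, e ▸ hw⟩
    · rintro ⟨c, hc, h⟩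
      exact ⟨_, h, Cls.smul ⟨v.2, rfl⟩ hc⟩
  obtain ⟨y, ⟨v, hv, hvy⟩, hy⟩ := mem_closure_iff.1 hx _ hV ⟨u, ⟨huN, hu⟩, hux⟩
  exact ⟨v, hv.1, hv.2, y, hy, hvy⟩

/-- closed cone -/
def cK (p : ℕ) : Set (Fin d → ℝ) :=
  {v | (∀ i : Fin d, 0 ≤ v i) ∧ ∀ i : Fin d, p ≤ (i : ℕ) → v i = 0}

lemma simplex_mem {p : ℕ} {S : Set (PSpace d)} {g : (Fin d → ℝ) ≃ₗ[ℝ] (Fin d → ℝ)}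
    (h : IsSimplexWithMap p S g) (y : PSpace d) :
    y ∈ S ↔ ∃ v ∈ simplexCone (d := d) p, Cls (g v) y := by
  unfold IsSimplexWithMap at h
  rw [h]
  constructor
  · rintro ⟨v, hv, h0, e⟩
    exact ⟨v, hv, _, e⟩
  · rintro ⟨v, hv, h0, e⟩
    exact ⟨v, hv, by simpa using h0, e⟩

lemma simplex_closure {p : ℕ} {S : Set (PSpace d)} {g : (Fin d → ℝ) ≃ₗ[ℝ] (Fin d → ℝ)}
    (h : IsSimplexWithMap p S g) (y : PSpace d) :
    y ∈ closure S ↔ ∃ v ∈ cK (d := d) p, Cls (g v) y := by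
  constructor
  · have hcl : IsClosed (cK (d := d) p) := by
      have : cK (d := d) p = (⋂ i : Fin d, {v | 0 ≤ v i}) ∩
          ⋂ i : Fin d, ⋂ _ : p ≤ (i : ℕ), {v | v i = 0} := by
        ext v; simp [cK]
      rw [this]
      refine IsClosed.inter (isClosed_iInter fun i => isClosed_le continuous_const (by fun_prop))
        (isClosed_iInter fun i => isClosed_iInter fun _ => isClosed_eq (by fun_prop) continuous_const)
    have hg : Continuous g.symm := g.symm.toLinearMap.continuous_of_finiteDimensional
    have hA : IsClosed {u : Fin d → ℝ | g.symm u ∈ cK (d := d) p ∨ -g.symm u ∈ cK (d := d) p} :=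
      (hcl.preimage hg).union (hcl.preimage hg.neg)
    have hK : ∀ c : ℝ, 0 ≤ c → ∀ v ∈ cK (d := d) p, c • v ∈ cK (d := d) p := by
      intro c hc v hv
      exact ⟨fun i => mul_nonneg hc (hv.1 i), fun i hi => by simp [hv.2 i hi]⟩
    have := isClosed_cls hA (by
      rintro c hc v (hv | hv)
      · rcases le_total 0 c with h | h
        · left; rw [map_smul]; exact hK c h _ hv
        · right; rw [map_smul, ← neg_smul]; exact hK (-c) (by linarith) _ hv
      · rcases le_total 0 c with h | h
        · right; rw [map_smul, ← smul_neg]; exact hK c h _ hv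
        · left; rw [map_smul, ← neg_smul_neg]; exact hK (-c) (by linarith) _ hv)
    intro hy
    have hy' := closure_minimal (fun z hz => ?_) this hy
    · obtain ⟨u, hu | hu, hc⟩ := hy'
      · exact ⟨_, hu, by simpa using hc⟩
      · exact ⟨_, hu, by simpa using hc.smul (c := -1) (by norm_num)⟩
    · obtain ⟨v, hv, hz⟩ := (simplex_mem h z).1 hz
      refine ⟨_, Or.inl ?_, hz⟩
      simp only [LinearEquiv.symm_apply_apply]
      refine ⟨fun i => ?_, hv.2⟩
      rcases lt_or_ge (i : ℕ) p with h | h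
      · exact (hv.1 i h).le
      · exact (hv.2 i h).ge
  · rintro ⟨v, hv, hy⟩
    refine cls_closure (A := g '' simplexCone (d := d) p) ?_ hy ?_
    · have hg : Continuous g := g.toLinearMap.continuous_of_finiteDimensional
      refine image_closure_subset_closure_image hg ⟨v, ?_, rfl⟩
      let e : Fin d → ℝ := fun i => if (i : ℕ) < p then 1 else 0
      have ht : Tendsto (fun t : ℝ => v + t • e) (nhdsWithin 0 (Ioi 0)) (nhds v) := by
        have : Continuous (fun t : ℝ => v + t • e) := by fun_prop
        have h1 := this.tendsto 0
        simp only [zero_smul, add_zero] at h1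
        exact h1.mono_left nhdsWithin_le_nhds
      refine mem_closure_of_tendsto ht ?_
      filter_upwards [self_mem_nhdsWithin] with t ht
      have ht : 0 < t := ht
      refine ⟨fun i hi => ?_, fun i hi => ?_⟩
      · have := hv.1 i
        simp [e, hi]; linarith
      · simp [e, not_lt.2 hi, hv.2 i hi]
    · rintro _ ⟨w, hw, rfl⟩ y hy
      exact (simplex_mem h y).2 ⟨w, hw, hy⟩

lemma simplex_neg {p : ℕ} {S : Set (PSpace d)} {g : (Fin d → ℝ) ≃ₗ[ℝ] (Fin d → ℝ)}
    (h : IsSimplexWithMap p S g) :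
    IsSimplexWithMap p S (g.trans (LinearEquiv.neg ℝ)) := by
  unfold IsSimplexWithMap
  ext y
  rw [simplex_mem h]
  constructor
  · rintro ⟨v, hv, hy⟩
    have h2 := hy.smul (c := -1) (by norm_num)
    refine ⟨v, hv, by simpa using hy.1, ?_⟩
    obtain ⟨h3, e⟩ := h2
    rw [e]
    congr 1
    simp
  · rintro ⟨v, hv, h0, e⟩
    refine ⟨v, hv, ?_⟩
    have : Cls ((g.trans (LinearEquiv.neg ℝ)) v) y := ⟨_, e⟩
    simpa using this.smul (c := -1) (by norm_num)

lemma cK_sign {p : ℕ} (F : (Fin d → ℝ) →ₗ[ℝ] ℝ) (hF : ∀ v ∈ cK (d := d) p, v ≠ 0 → F v ≠ 0) :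
    (∀ v ∈ cK (d := d) p, v ≠ 0 → 0 < F v) ∨ (∀ v ∈ cK (d := d) p, v ≠ 0 → 0 < -F v) := by
  by_contra hcon
  push Not at hcon
  obtain ⟨⟨v, hv, hv0, h1⟩, w, hw, hw0, h2⟩ := hcon
  have h1 : F v < 0 := lt_of_le_of_ne h1 (hF v hv hv0)
  have h2 : 0 < F w := lt_of_le_of_ne (by linarith) (hF w hw hw0).symm
  refine hF (F w • v + (-F v) • w) ⟨fun i => ?_, fun i hi => ?_⟩ ?_ ?_
  · have := hv.1 i
    have := hw.1 i
    have : 0 < -F v := by linarith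
    simp only [Pi.add_apply, Pi.smul_apply, smul_eq_mul]
    positivity
  · simp [hv.2 i hi, hw.2 i hi]
  · intro h0
    apply hv0
    ext i
    have h := congrFun h0 i
    simp only [Pi.add_apply, Pi.smul_apply, smul_eq_mul, Pi.zero_apply] at h
    have a1 : 0 ≤ F w * v i := mul_nonneg h2.le (hv.1 i)
    have a2 : 0 ≤ -F v * w i := mul_nonneg (by linarith) (hw.1 i)
    have : F w * v i = 0 := by linarith
    simpa [h2.ne'] using this
  · simp; ring

lemma exists_pos {p : ℕ} {S : Set (PSpace d)} {g : (Fin d → ℝ) ≃ₗ[ℝ] (Fin d → ℝ)}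
    (h : IsSimplexWithMap p S g) (f : (Fin d → ℝ) →ₗ[ℝ] ℝ) (hf : ∀ x ∈ closure S, f x.rep ≠ 0) :
    ∃ g' : (Fin d → ℝ) ≃ₗ[ℝ] (Fin d → ℝ), IsSimplexWithMap p S g' ∧
      (∀ v y, Cls (g v) y ↔ Cls (g' v) y) ∧ ∀ v ∈ cK (d := d) p, v ≠ 0 → 0 < f (g' v) := by
  have hF : ∀ v ∈ cK (d := d) p, v ≠ 0 → (f ∘ₗ g.toLinearMap) v ≠ 0 := by
    intro v hv h0
    have hc : Cls (g v) (Projectivization.mk ℝ (g v) (by simpa using h0)) := ⟨_, rfl⟩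
    exact (hc.ne_iff f).1 (hf _ ((simplex_closure h _).2 ⟨v, hv, hc⟩))
  rcases cK_sign _ hF with h1 | h1
  · exact ⟨g, h, fun _ _ => Iff.rfl, h1⟩
  · refine ⟨_, simplex_neg h, fun v y => ⟨fun hc => ?_, fun hc => ?_⟩, fun v hv h0 => ?_⟩
    · simpa using hc.smul (c := -1) (by norm_num)
    · simpa using hc.smul (c := -1) (by norm_num)
    · simpa using h1 v hv h0

lemma cK_smul {p : ℕ} {c : ℝ} (hc : 0 ≤ c) {v : Fin d → ℝ} (hv : v ∈ cK (d := d) p) :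
    c • v ∈ cK (d := d) p :=
  ⟨fun i => mul_nonneg hc (hv.1 i), fun i hi => by simp [hv.2 i hi]⟩

/-- normalised representative -/
lemma norm_rep {p : ℕ} {g : (Fin d → ℝ) ≃ₗ[ℝ] (Fin d → ℝ)} {f : (Fin d → ℝ) →ₗ[ℝ] ℝ}
    (hf : ∀ v ∈ cK (d := d) p, v ≠ 0 → 0 < f (g v)) {x : PSpace d} {w : Fin d → ℝ}
    (hw : w ∈ cK (d := d) p) (hx : Cls (g w) x) :
    ∃ w' ∈ cK (d := d) p, Cls (g w') x ∧ (∀ i, w' i = 0 ↔ w i = 0) ∧ f (g w') = 1 ∧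
      chartMap f x = g w' := by
  have hw0 : w ≠ 0 := by simpa using hx.1
  have hp := hf w hw hw0
  refine ⟨(f (g w))⁻¹ • w, cK_smul (inv_nonneg.2 hp.le) hw, ?_, fun i => ?_, ?_, ?_⟩
  · rw [map_smul]; exact hx.smul (inv_ne_zero hp.ne')
  · simp [hp.ne']
  · simp [hp.ne']
  · rw [hx.chart, map_smul]

lemma lemA {p : ℕ} {S : Set (PSpace d)} {g : (Fin d → ℝ) ≃ₗ[ℝ] (Fin d → ℝ)}
    (h : IsSimplexWithMap p S g) {f : (Fin d → ℝ) →ₗ[ℝ] ℝ}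
    (hf : ∀ v ∈ cK (d := d) p, v ≠ 0 → 0 < f (g v)) {x y : PSpace d} {w v : Fin d → ℝ}
    (hw : w ∈ cK (d := d) p) (hv : v ∈ cK (d := d) p) (hx : Cls (g w) x) (hy : Cls (g v) y)
    (hs : ∀ i, v i = 0 ↔ w i = 0) :
    ∃ a ∈ closure S, ∃ b ∈ closure S,
      chartMap f x ∈ openSegment ℝ (chartMap f a) (chartMap f b) ∧
      chartMap f y ∈ openSegment ℝ (chartMap f a) (chartMap f b) := by
  obtain ⟨w, hw, hx, hs1, hw1, ex⟩ := norm_rep hf hw hx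
  obtain ⟨v, hv, hy, hs2, hv1, ey⟩ := norm_rep hf hv hy
  have hs' : ∀ i, v i = 0 ↔ w i = 0 := fun i => by rw [hs1, hs2, hs]
  have key : ∀ w v : Fin d → ℝ, w ∈ cK (d := d) p → v ∈ cK (d := d) p →
      (∀ i, v i = 0 ↔ w i = 0) →
      ∀ᶠ ε : ℝ in nhdsWithin 0 (Ioi 0), w + ε • (w - v) ∈ cK (d := d) p := by
    intro w v hw hv hs
    have : ∀ i, ∀ᶠ ε : ℝ in nhdsWithin 0 (Ioi 0), 0 ≤ (w + ε • (w - v)) i := by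
      intro i
      rcases eq_or_lt_of_le (hw.1 i) with h0 | h0
      · have := (hs i).2 h0.symm
        simp [this, ← h0]
      · have hc : Continuous fun ε : ℝ => (w + ε • (w - v)) i := by
          simp only [Pi.add_apply, Pi.smul_apply, Pi.sub_apply, smul_eq_mul]; fun_prop
        have h1 := hc.tendsto 0
        simp only [zero_smul, add_zero] at h1
        exact ((h1.mono_left nhdsWithin_le_nhds).eventually (lt_mem_nhds h0)).mono fun _ h => h.le
    filter_upwards [eventually_all.2 this] with ε hε
    exact ⟨hε, fun i hi => by simp [hw.2 i hi, hv.2 i hi]⟩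
  obtain ⟨ε, ⟨h1, h2⟩, hε⟩ := (((key w v hw hv hs').and
    (key v w hv hw (fun i => (hs' i).symm))).and self_mem_nhdsWithin).exists
  have hε : 0 < ε := hε
  have f1 : f (g (w + ε • (w - v))) = 1 := by simp [hw1, hv1]
  have f2 : f (g (v + ε • (v - w))) = 1 := by simp [hw1, hv1]
  have n1 : g (w + ε • (w - v)) ≠ 0 := by intro h; rw [h] at f1; simp at f1
  have n2 : g (v + ε • (v - w)) ≠ 0 := by intro h; rw [h] at f2; simp at f2
  have c1 : Cls (g (w + ε • (w - v))) (Projectivization.mk ℝ _ n1) := ⟨n1, rfl⟩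
  have c2 : Cls (g (v + ε • (v - w))) (Projectivization.mk ℝ _ n2) := ⟨n2, rfl⟩
  refine ⟨_, (simplex_closure h _).2 ⟨_, h1, c1⟩, _, (simplex_closure h _).2 ⟨_, h2, c2⟩, ?_⟩
  rw [c1.chart, c2.chart, f1, f2, inv_one, one_smul, one_smul, ex, ey]
  constructor
  · refine ⟨(1 + ε) / (1 + 2 * ε), ε / (1 + 2 * ε), by positivity, by positivity, by field_simp; ring, ?_⟩
    rw [← map_smul, ← map_smul, ← map_add]
    congr 1
    ext i
    simp only [Pi.add_apply, Pi.smul_apply, Pi.sub_apply, smul_eq_mul]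
    field_simp
    ring
  · refine ⟨ε / (1 + 2 * ε), (1 + ε) / (1 + 2 * ε), by positivity, by positivity, by field_simp; ring, ?_⟩
    rw [← map_smul, ← map_smul, ← map_add]
    congr 1
    ext i
    simp only [Pi.add_apply, Pi.smul_apply, Pi.sub_apply, smul_eq_mul]
    field_simp
    ring

lemma lemB {p : ℕ} {S : Set (PSpace d)} {g : (Fin d → ℝ) ≃ₗ[ℝ] (Fin d → ℝ)}
    (h : IsSimplexWithMap p S g) {f : (Fin d → ℝ) →ₗ[ℝ] ℝ}
    (hf : ∀ v ∈ cK (d := d) p, v ≠ 0 → 0 < f (g v)) {x y : PSpace d} {w v : Fin d → ℝ}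
    (hw : w ∈ cK (d := d) p) (hv : v ∈ cK (d := d) p) (hx : Cls (g w) x) (hy : Cls (g v) y)
    {a b : PSpace d} (ha : a ∈ closure S) (hb : b ∈ closure S)
    (h1 : chartMap f x ∈ openSegment ℝ (chartMap f a) (chartMap f b))
    (h2 : chartMap f y ∈ openSegment ℝ (chartMap f a) (chartMap f b)) :
    ∀ i, v i = 0 ↔ w i = 0 := by
  obtain ⟨w, hw, hx, hs1, hw1, ex⟩ := norm_rep hf hw hx
  obtain ⟨v, hv, hy, hs2, hv1, ey⟩ := norm_rep hf hv hy
  obtain ⟨α, hα, hca⟩ := (simplex_closure h _).1 ha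
  obtain ⟨β, hβ, hcb⟩ := (simplex_closure h _).1 hb
  obtain ⟨α, hα, -, -, -, ea⟩ := norm_rep hf hα hca
  obtain ⟨β, hβ, -, -, -, eb⟩ := norm_rep hf hβ hcb
  rw [ex, ea, eb] at h1
  rw [ey, ea, eb] at h2
  have key : ∀ u, g u ∈ openSegment ℝ (g α) (g β) → ∀ i, u i = 0 ↔ (α i = 0 ∧ β i = 0) := by
    rintro u ⟨s, t, hs, ht, -, e⟩ i
    rw [← map_smul, ← map_smul, ← map_add] at e
    have e := congrFun (g.injective e) i
    simp only [Pi.add_apply, Pi.smul_apply, smul_eq_mul] at e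
    rw [← e]
    have a1 := mul_nonneg hs.le (hα.1 i)
    have a2 := mul_nonneg ht.le (hβ.1 i)
    rw [add_eq_zero_iff_of_nonneg a1 a2]
    simp [hs.ne', ht.ne']
  intro i
  rw [← hs1, ← hs2, key w h1, key v h2]

lemma seg_ext {E : Type*} [AddCommGroup E] [Module ℝ E] {a b x y : E}
    (hx : x ∈ openSegment ℝ a b) (hy : y ∈ openSegment ℝ a b) :
    ∃ ε : ℝ, 0 < ε ∧ x + ε • (x - y) ∈ segment ℝ a b := by
  obtain ⟨s', s, hs', hs, h1, rfl⟩ := hx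
  obtain ⟨t', t, ht', ht, h2, rfl⟩ := hy
  obtain rfl : s' = 1 - s := by linarith
  obtain rfl : t' = 1 - t := by linarith
  refine ⟨s * (1 - s), by positivity, 1 - (s + s * (1 - s) * (s - t)),
    s + s * (1 - s) * (s - t), ?_, ?_, by ring, by module⟩
  · have : s * (1 - s) * (s - t) ≤ s * (1 - s) * 1 := by gcongr; linarith
    nlinarith
  · have : s * (1 - s) * (-1) ≤ s * (1 - s) * (s - t) := by gcongr; linarith
    nlinarith

lemma lemC {p : ℕ} {Ω S : Set (PSpace d)} {g : (Fin d → ℝ) ≃ₗ[ℝ] (Fin d → ℝ)}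
    (h : IsSimplexWithMap p S g) {f : (Fin d → ℝ) →ₗ[ℝ] ℝ}
    (hf : ∀ v ∈ cK (d := d) p, v ≠ 0 → 0 < f (g v))
    (hΩ : IsOpen Ω) (hfΩ : ∀ x ∈ closure Ω, f x.rep ≠ 0) (hconv : Convex ℝ (chartMap f '' Ω))
    (hSΩ : S ⊆ Ω) (hcl : closure S ∩ Ω ⊆ S)
    {x y : PSpace d} {w v : Fin d → ℝ}
    (hw : w ∈ cK (d := d) p) (hv : v ∈ cK (d := d) p) (hx : Cls (g w) x) (hy : Cls (g v) y)
    {a b : PSpace d} (ha : a ∈ closure Ω) (hb : b ∈ closure Ω)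
    (h1 : chartMap f x ∈ openSegment ℝ (chartMap f a) (chartMap f b))
    (h2 : chartMap f y ∈ openSegment ℝ (chartMap f a) (chartMap f b)) :
    ∀ i, w i = 0 → v i = 0 := by
  obtain ⟨w, hw, hx, hs1, hw1, ex⟩ := norm_rep hf hw hx
  obtain ⟨v, hv, hy, hs2, hv1, ey⟩ := norm_rep hf hv hy
  intro i
  rw [← hs1, ← hs2]
  intro hwi
  by_contra hvi
  have hvi : 0 < v i := lt_of_le_of_ne (hv.1 i) (Ne.symm hvi)
  rw [ex] at h1
  rw [ey] at h2
  obtain ⟨ε, hε, hz⟩ := seg_ext h1 h2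
  have hcc := coneOver_convex f (fun x hx => hfΩ x (subset_closure hx)) hconv
  have hco := coneOver_open f hΩ
  have hmem : ∀ c ∈ closure Ω, chartMap f c ∈ closure (coneOver f Ω) := by
    intro c hc
    refine mem_closure_coneOver f hc ?_ ((cls_rep c).smul (inv_ne_zero (hfΩ c hc)))
    unfold chartMap
    rw [map_smul, smul_eq_mul, inv_mul_cancel₀ (hfΩ c hc)]
    exact one_pos
  have hz := hcc.closure.segment_subset (hmem a ha) (hmem b hb) hz
  let u : Fin d → ℝ := fun j => if (j : ℕ) < p ∧ j ≠ i then 1 else 0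
  have hu0 : ∀ j, 0 ≤ u j := fun j => by simp only [u]; split_ifs <;> norm_num
  have hup : ∀ j : Fin d, p ≤ (j : ℕ) → u j = 0 := fun j hj => by simp [u, not_lt.2 hj]
  have hq : v + u ∈ simplexCone (d := d) p := by
    refine ⟨fun j hj => ?_, fun j hj => by simp [hv.2 j hj, hup j hj]⟩
    by_cases hji : j = i
    · subst hji; simp [u, hvi]
    · have := hv.1 j
      simp [u, hji, hj]; linarith
  have hqK : v + u ∈ cK (d := d) p :=
    ⟨fun j => add_nonneg (hv.1 j) (hu0 j), hq.2⟩
  have hq0 : v + u ≠ 0 := by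
    intro h0
    have := congrFun h0 i
    simp [u] at this
    linarith
  have hgq : g (v + u) ∈ coneOver f Ω := by
    have hc : Cls (g (v + u)) (Projectivization.mk ℝ (g (v + u)) (g.map_ne_zero_iff.2 hq0)) := ⟨_, rfl⟩
    exact ⟨hf _ hqK hq0, _, hSΩ ((simplex_mem h _).2 ⟨_, hq, hc⟩), hc⟩
  have hmid : (ε / (1 + ε)) • g (v + u) + (1 / (1 + ε)) • (g w + ε • (g w - g v)) ∈
      coneOver f Ω := by
    have := hcc.openSegment_interior_closure_subset_interior
      (hco.interior_eq.symm ▸ hgq) hz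
    rw [hco.interior_eq] at this
    exact this ⟨_, _, by positivity, by positivity, by field_simp; ring, rfl⟩
  have hm : (ε / (1 + ε)) • g (v + u) + (1 / (1 + ε)) • (g w + ε • (g w - g v)) =
      g ((ε / (1 + ε)) • u + w) := by
    rw [← map_sub, ← map_smul, ← map_smul, ← map_add, ← map_smul, ← map_add]
    congr 1
    ext j
    simp only [Pi.add_apply, Pi.smul_apply, Pi.sub_apply, smul_eq_mul]
    field_simp
    ring
  rw [hm] at hmid
  obtain ⟨-, z, hzΩ, hcz⟩ := hmid
  have hzS : z ∈ S := by
    refine hcl ⟨(simplex_closure h z).2 ⟨_, ⟨fun j => ?_, fun j hj => ?_⟩, hcz⟩, hzΩ⟩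
    · have := hu0 j
      have := hw.1 j
      simp only [Pi.add_apply, Pi.smul_apply, smul_eq_mul]
      positivity
    · simp [hup j hj, hw.2 j hj]
  obtain ⟨n, hn, hcn⟩ := (simplex_mem h z).1 hzS
  obtain ⟨c, hc, e⟩ := hcz.inj hcn
  rw [← map_smul] at e
  have e := congrFun (g.injective e) i
  simp [u, hwi] at e
  have hip : (i : ℕ) < p := by
    by_contra hh
    have := hv.2 i (not_lt.1 hh)
    linarith
  have := hn.1 i hip
  linarith

lemma chartOf_spec {C : Set (PSpace d)} (h : IsProperlyConvex C) :
    (∀ x ∈ closure C, chartOf C x.rep ≠ 0) ∧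
    Convex ℝ (chartMap (chartOf C) '' C) ∧ Bornology.IsBounded (chartMap (chartOf C) '' C) := by
  unfold chartOf
  rw [dif_pos h]
  exact h.choose_spec

lemma simplex_pc {p : ℕ} {Ω S : Set (PSpace d)} {g : (Fin d → ℝ) ≃ₗ[ℝ] (Fin d → ℝ)}
    (h : IsSimplexWithMap p S g) (hSΩ : S ⊆ Ω) (hΩ : IsProperlyConvex Ω) :
    IsProperlyConvex S := by
  obtain ⟨f, h1, h2, h3⟩ := hΩ
  have h1' : ∀ x ∈ closure S, f x.rep ≠ 0 := fun x hx => h1 x (closure_mono hSΩ hx)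
  refine ⟨f, h1', ?_, h3.subset (image_mono hSΩ)⟩
  obtain ⟨g', hg', -, hpos⟩ := exists_pos h f h1'
  have hsub : ∀ v ∈ simplexCone (d := d) p, v ∈ cK (d := d) p := by
    intro v hv
    refine ⟨fun i => ?_, hv.2⟩
    rcases lt_or_ge (i : ℕ) p with h | h
    · exact (hv.1 i h).le
    · exact (hv.2 i h).ge
  have : chartMap f '' S = g'.toLinearMap '' (simplexCone (d := d) p) ∩ {u | f u = 1} := by
    ext u
    constructor
    · rintro ⟨x, hx, rfl⟩
      obtain ⟨v, hv, hc⟩ := (simplex_mem hg' x).1 hx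
      have hp := hpos v (hsub v hv) (by simpa using hc.1)
      rw [hc.chart]
      refine ⟨⟨(f (g' v))⁻¹ • v, ⟨fun i hi => ?_, fun i hi => by simp [hv.2 i hi]⟩, by simp⟩, by simp [hp.ne']⟩
      have := hv.1 i hi
      simp only [Pi.smul_apply, smul_eq_mul]
      positivity
    · rintro ⟨⟨v, hv, rfl⟩, h1⟩
      have h1 : f (g' v) = 1 := h1
      have hne : g' v ≠ 0 := by intro h; rw [h] at h1; simp at h1
      have hc : Cls (g' v) (Projectivization.mk ℝ (g' v) hne) := ⟨_, rfl⟩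
      exact ⟨_, (simplex_mem hg' _).2 ⟨v, hv, hc⟩, by rw [hc.chart, h1]; simp⟩
  rw [this]
  refine Convex.inter (Convex.linear_image ?_ _) ?_
  · rw [convex_iff_forall_pos]
    intro v hv w hw a b ha hb _
    refine ⟨fun i hi => ?_, fun i hi => by simp [hv.2 i hi, hw.2 i hi]⟩
    have := hv.1 i hi
    have := hw.1 i hi
    simp only [Pi.add_apply, Pi.smul_apply, smul_eq_mul]
    positivity
  · intro v hv w hw a b _ _ hab
    simp only [mem_ofPred_eq] at *
    simp [hv, hw, hab]

lemma exists_perm (P : Fin d → Prop) [DecidablePred P] (n : ℕ) (hn : n ≤ d)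
    (h : Fintype.card {i // P i} = n) :
    ∃ σ : Equiv.Perm (Fin d), ∀ i, P (σ i) ↔ (i : ℕ) < n := by
  have hc : Fintype.card {i : Fin d // (i : ℕ) < n} = Fintype.card {i // P i} := by
    rw [h, Fintype.card_subtype, Fin.card_filter_val_lt]
    exact min_eq_right hn
  let e := Fintype.equivOfCardEq hc
  refine ⟨e.extendSubtype, fun i => ⟨fun hp => ?_, fun hi => e.extendSubtype_mem i hi⟩⟩
  by_contra hi
  exact e.extendSubtype_not_mem i hi hp

lemma face_simplex {g : (Fin d → ℝ) ≃ₗ[ℝ] (Fin d → ℝ)} {w : Fin d → ℝ} (hw0 : w ≠ 0) :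
    ∃ m, IsSimplexOfDim m {y : PSpace d | ∃ v : Fin d → ℝ, (∀ i, 0 ≤ v i) ∧
      (∀ i, v i = 0 ↔ w i = 0) ∧ Cls (g v) y} := by
  classical
  set n := Fintype.card {i // w i ≠ 0} with hn
  have hpos : 0 < n := by
    obtain ⟨i, hi⟩ := Function.ne_iff.1 hw0
    exact Fintype.card_pos_iff.2 ⟨⟨i, hi⟩⟩
  have hnd : n ≤ d := by
    have := Fintype.card_subtype_le (fun i => w i ≠ 0)
    rwa [Fintype.card_fin] at this
  obtain ⟨σ, hσ⟩ := exists_perm (fun i => w i ≠ 0) n hnd hn.symm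
  refine ⟨n - 1, by omega, (LinearEquiv.funCongrLeft ℝ ℝ σ.symm).trans g, ?_⟩
  rw [Nat.sub_add_cancel hpos]
  unfold IsSimplexWithMap
  ext y
  constructor
  · rintro ⟨v, h0, hs, hc⟩
    have hv0 : v ≠ 0 := by simpa using hc.1
    have e : (LinearEquiv.funCongrLeft ℝ ℝ σ.symm) (v ∘ σ) = v := by
      ext i; simp [LinearEquiv.funCongrLeft_apply, LinearMap.funLeft_apply]
    refine ⟨v ∘ σ, ⟨fun i hi => ?_, fun i hi => ?_⟩, ?_, ?_⟩
    · have : w (σ i) ≠ 0 := (hσ i).2 hi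
      exact lt_of_le_of_ne (h0 _) (fun h => this ((hs _).1 h.symm))
    · by_contra hh
      have := (hσ i).1 (fun h => hh ((hs _).2 h))
      omega
    · intro h; rw [h] at e; simp at e; exact hv0 e.symm
    · obtain ⟨h1, rfl⟩ := hc
      congr 1
      simp [e]
  · rintro ⟨v, hv, h0, rfl⟩
    have hi' : ∀ i, (LinearEquiv.funCongrLeft ℝ ℝ σ.symm) v i = v (σ.symm i) := fun i => by
      simp [LinearEquiv.funCongrLeft_apply, LinearMap.funLeft_apply]
    refine ⟨(LinearEquiv.funCongrLeft ℝ ℝ σ.symm) v, fun i => ?_, fun i => ?_, _, rfl⟩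
    · rw [hi']
      rcases lt_or_ge (σ.symm i : ℕ) n with h | h
      · exact (hv.1 _ h).le
      · exact (hv.2 _ h).ge
    · rw [hi']
      have := hσ (σ.symm i)
      rw [Equiv.apply_symm_apply] at this
      rcases lt_or_ge (σ.symm i : ℕ) n with h | h
      · have a1 := this.2 h
        have a2 := (hv.1 _ h).ne'
        simp [a1, a2]
      · have a1 : w i = 0 := by
          by_contra hh
          have := this.1 hh
          omega
        simp [a1, hv.2 _ h]

/-- Observation 2.8: for a properly embedded simplex `S ⊆ Ω` and `x ∈ ∂S`,
the face `F_S(x)` is a properly embedded simplex in `F_Ω(x)`, and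
`F_S(x) = closure S ∩ F_Ω(x)`. -/
theorem face_of_properly_embedded_simplex {d : ℕ} (Ω S : Set (PSpace d)) (hΩ : IsPCDomain Ω)
    (k : ℕ) (hS : IsSimplexOfDim k S) (hSpe : IsProperlyEmbedded S Ω)
    (x : PSpace d) (hx : x ∈ closure S \ S) :
    (∃ m : ℕ, IsSimplexOfDim m (face S x)) ∧
    IsProperlyEmbedded (face S x) (face Ω x) ∧
    face S x = closure S ∩ face Ω x := by
  obtain ⟨hopen, -, hpc⟩ := hΩ
  obtain ⟨hkd, g, hg⟩ := hS
  obtain ⟨hSΩ, hprop⟩ := hSpe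
  have hcl : closure S ∩ Ω ⊆ S := by
    have hr : IsClosed (range (Set.inclusion hSΩ)) := hprop.isClosedMap.isClosed_range
    rw [Set.range_inclusion] at hr
    obtain ⟨T, hT, e⟩ := isClosed_induced_iff.1 hr
    rintro z ⟨hz, hzΩ⟩
    have hST : S ⊆ T := by
      intro s hs
      have : (⟨s, hSΩ hs⟩ : Ω) ∈ (Subtype.val ⁻¹' T : Set Ω) := by rw [e]; exact hs
      exact this
    have hzT : z ∈ T := closure_minimal hST hT hz
    have : (⟨z, hzΩ⟩ : Ω) ∈ (Subtype.val ⁻¹' T : Set Ω) := hzT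
    rw [e] at this
    exact this
  obtain ⟨hΩ1, hΩ2, -⟩ := chartOf_spec hpc
  obtain ⟨hS1, -, -⟩ := chartOf_spec (simplex_pc hg hSΩ hpc)
  obtain ⟨g1, hg1, hc1, hp1⟩ := exists_pos hg (chartOf S) hS1
  obtain ⟨g2, hg2, hc2, hp2⟩ := exists_pos hg (chartOf Ω)
    (fun x hx => hΩ1 x (closure_mono hSΩ hx))
  obtain ⟨w, hw, hxw⟩ := (simplex_closure hg x).1 hx.1
  have hface : face S x = {y : PSpace d | ∃ v : Fin d → ℝ, (∀ i, 0 ≤ v i) ∧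
      (∀ i, v i = 0 ↔ w i = 0) ∧ Cls (g v) y} := by
    ext y
    constructor
    · rintro (rfl | ⟨hy, a, ha, b, hb, h1, h2⟩)
      · exact ⟨w, hw.1, fun _ => Iff.rfl, hxw⟩
      · obtain ⟨v, hv, hyv⟩ := (simplex_closure hg y).1 hy
        exact ⟨v, hv.1, lemB hg1 hp1 hw hv ((hc1 _ _).1 hxw) ((hc1 _ _).1 hyv) ha hb h1.2 h2.2, hyv⟩
    · rintro ⟨v, h0, hs, hyv⟩
      have hv : v ∈ cK (d := d) (k + 1) := ⟨h0, fun i hi => (hs i).2 (hw.2 i hi)⟩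
      obtain ⟨a, ha, b, hb, h1, h2⟩ :=
        lemA hg1 hp1 hw hv ((hc1 _ _).1 hxw) ((hc1 _ _).1 hyv) hs
      have hy := (simplex_closure hg y).2 ⟨v, hv, hyv⟩
      exact Or.inr ⟨hy, a, ha, b, hb, ⟨hx.1, h1⟩, hy, h2⟩
  have hmain : face S x = closure S ∩ face Ω x := by
    rw [hface]
    ext y
    constructor
    · rintro ⟨v, h0, hs, hyv⟩
      have hv : v ∈ cK (d := d) (k + 1) := ⟨h0, fun i hi => (hs i).2 (hw.2 i hi)⟩
      obtain ⟨a, ha, b, hb, h1, h2⟩ :=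
        lemA hg2 hp2 hw hv ((hc2 _ _).1 hxw) ((hc2 _ _).1 hyv) hs
      have hy := (simplex_closure hg y).2 ⟨v, hv, hyv⟩
      have hm := closure_mono hSΩ
      exact ⟨hy, Or.inr ⟨hm hy, a, hm ha, b, hm hb, ⟨hm hx.1, h1⟩, hm hy, h2⟩⟩
    · rintro ⟨hy, rfl | ⟨-, a, ha, b, hb, h1, h2⟩⟩
      · exact ⟨w, hw.1, fun _ => Iff.rfl, hxw⟩
      · obtain ⟨v, hv, hyv⟩ := (simplex_closure hg y).1 hy
        refine ⟨v, hv.1, fun i => ⟨?_, ?_⟩, hyv⟩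
        · exact lemC hg2 hp2 hopen hΩ1 hΩ2 hSΩ hcl hv hw ((hc2 _ _).1 hyv) ((hc2 _ _).1 hxw)
            ha hb h2.2 h1.2 i
        · exact lemC hg2 hp2 hopen hΩ1 hΩ2 hSΩ hcl hw hv ((hc2 _ _).1 hxw) ((hc2 _ _).1 hyv)
            ha hb h1.2 h2.2 i
  refine ⟨?_, ?_, hmain⟩
  · rw [hface]
    exact face_simplex (by simpa using hxw.1)
  · have hsub : face S x ⊆ face Ω x := by rw [hmain]; exact inter_subset_right
    refine ⟨hsub, Topology.IsClosedEmbedding.isProperMap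
      ⟨Topology.IsEmbedding.inclusion hsub, ?_⟩⟩
    rw [Set.range_inclusion]
    have : {z : face Ω x | (z : PSpace d) ∈ face S x} = Subtype.val ⁻¹' closure S := by
      ext z
      simp only [mem_ofPred_eq, mem_preimage]
      rw [hmain]
      exact ⟨fun h => h.1, fun h => ⟨h, z.2⟩⟩
    rw [this]
    exact isClosed_closure.preimage continuous_subtype_val

end Paper
end
end
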